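/- Let A, B, X, Y be polynomials with complex coefficients such that deg A ≥ 2, deg B ≥ 2, X and Y are nonconstant, X ∘ B = A ∘ X, and Y ∘ A = B ∘ Y (i.e., A and B are mutually semiconjugate via polynomial semiconjugacies). Then A and B are equivalent: they are related by the equivalence relation generated by the elementary-transformation relation R, where R f g holds iff there exist polynomials U, V with f = U ∘ V and g = V ∘ U. -/

import Mathlib

open Polynomial

theorem exists_isCoprime_of_mem_adjoin_simple (F g : RatFunc ℂ)
    (hF : F ∈ IntermediateField.adjoin ℂ {g}) :
    ∃ U V : ℂ[X], IsCoprime U V ∧ aeval g V ≠ 0 ∧ F * aeval g V = aeval g U := by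
  obtain ⟨r, s, hrs⟩ := (IntermediateField.mem_adjoin_simple_iff ℂ F).1 hF
  by_cases hs : aeval g s = 0
  · exact ⟨0, 1, isCoprime_one_right, by simp, by simp [hrs, hs]⟩
  · obtain ⟨U, V, hU, hV, hu⟩ := extract_gcd r s
    rw [hV, map_mul] at hs
    refine ⟨U, V, (gcd_isUnit_iff U V).1 hu, right_ne_zero_of_mul hs, ?_⟩
    have h0 := left_ne_zero_of_mul hs
    have h1 := right_ne_zero_of_mul hs
    have hr : aeval g r = aeval g (gcd r s) * aeval g U := by rw [← map_mul, ← hU]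
    have hs' : aeval g s = aeval g (gcd r s) * aeval g V := by rw [← map_mul, ← hV]
    rw [hrs, hr, hs']
    field_simp

theorem isIntegral_inv_of_inv_mem_adjoin {R K : Type*} [CommRing R] [Nontrivial R] [Field K]
    [Algebra R K] {k : K} (hk : k⁻¹ ∈ Algebra.adjoin R {k}) : IsIntegral R k⁻¹ := by
  by_cases hk0 : k = 0
  · simpa [hk0] using isIntegral_zero
  rw [Algebra.adjoin_singleton_eq_range_aeval] at hk
  obtain ⟨W, hW⟩ := hk
  refine ⟨X ^ (W.natDegree + 1) - W.reverse, monic_X_pow_sub ?_, ?_⟩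
  · refine (degree_le_of_natDegree_le (reverse_natDegree_le W)).trans_lt ?_
    exact_mod_cast Nat.lt_succ_self _
  · let := invertibleOfNonzero hk0
    have h := eval₂_reverse_mul_pow (algebraMap R K) k W
    rw [invOf_eq_inv] at h
    have hW' : eval₂ (algebraMap R K) k W = k⁻¹ := hW
    rw [hW'] at h
    have hkn : k ^ W.natDegree ≠ 0 := pow_ne_zero _ hk0
    rw [eval₂_sub, eval₂_X_pow, sub_eq_zero]
    refine mul_right_cancel₀ hkn ?_
    rw [h, pow_succ, mul_right_comm, ← mul_pow, inv_mul_cancel₀ hk0, one_pow, one_mul]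

theorem exists_polynomial_generator (g : RatFunc ℂ) (F : ℂ[X]) (hF : 1 ≤ F.natDegree)
    (hFg : algebraMap ℂ[X] (RatFunc ℂ) F ∈ IntermediateField.adjoin ℂ {g}) :
    ∃ h : ℂ[X], IntermediateField.adjoin ℂ {algebraMap ℂ[X] (RatFunc ℂ) h} =
      IntermediateField.adjoin ℂ {g} := by
  obtain ⟨U, V, hco, hV, hUV⟩ := exists_isCoprime_of_mem_adjoin_simple _ g hFg
  have hbridge : ∀ (S : Subalgebra ℂ[X] (RatFunc ℂ)), g ∈ S → ∀ p : ℂ[X], aeval g p ∈ S := by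
    intro S hg p
    exact (Algebra.adjoin_le (S := S.restrictScalars ℂ) (by simpa using hg) :
      Algebra.adjoin ℂ {g} ≤ _) (aeval_mem_adjoin_singleton ℂ g)
  by_cases hroot : ∃ v, V.IsRoot v
  · obtain ⟨v, hv⟩ := hroot
    obtain ⟨V₁, rfl⟩ := dvd_iff_isRoot.2 hv
    obtain ⟨a, b, hab⟩ := hco
    set k := g - algebraMap ℂ (RatFunc ℂ) v with hk
    have hk0 : k ≠ 0 := by
      intro h0
      apply hV
      rw [map_mul, map_sub, aeval_X, aeval_C, ← hk, h0, zero_mul]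
    have hg : g ∈ Algebra.adjoin ℂ[X] {k} := by
      have : g = k + algebraMap ℂ[X] (RatFunc ℂ) (C v) := by
        rw [hk]; simp
      rw [this]
      exact add_mem (Algebra.self_mem_adjoin_singleton _ _) (Subalgebra.algebraMap_mem _ _)
    have hinv : k⁻¹ = aeval g V₁ * (aeval g a * algebraMap ℂ[X] (RatFunc ℂ) F + aeval g b) := by
      have h1 := congrArg (aeval g) hab
      rw [map_add, map_mul, map_mul, map_mul, ← hUV, map_mul, map_sub, aeval_X, aeval_C, ← hk,
        map_one] at h1
      apply inv_eq_of_mul_eq_one_right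
      linear_combination h1
    have hint : IsIntegral ℂ[X] k⁻¹ := by
      apply isIntegral_inv_of_inv_mem_adjoin
      rw [hinv]
      exact mul_mem (hbridge _ hg _) (add_mem (mul_mem (hbridge _ hg _)
        (Subalgebra.algebraMap_mem _ _)) (hbridge _ hg _))
    obtain ⟨h, hh⟩ := IsIntegrallyClosed.isIntegral_iff.1 hint
    refine ⟨h, ?_⟩
    rw [hh]
    apply le_antisymm
    · rw [IntermediateField.adjoin_simple_le_iff]
      exact inv_mem (sub_mem (IntermediateField.mem_adjoin_simple_self _ _)
        (IntermediateField.algebraMap_mem _ _))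
    · rw [IntermediateField.adjoin_simple_le_iff]
      have : g = (k⁻¹)⁻¹ + algebraMap ℂ (RatFunc ℂ) v := by rw [inv_inv, hk]; ring
      rw [this]
      exact add_mem (inv_mem (by exact IntermediateField.mem_adjoin_simple_self ℂ (k⁻¹)))
        (IntermediateField.algebraMap_mem _ _)
  · have hdeg : V.degree = 0 := by
      by_contra hne
      exact hroot (IsAlgClosed.exists_root V hne)
    obtain ⟨c, hc⟩ : ∃ c, V = C c := ⟨_, eq_C_of_degree_eq_zero hdeg⟩
    have hc0 : c ≠ 0 := by
      rintro rfl
      simp [hc] at hdeg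
    rw [hc, aeval_C] at hUV
    have hUV' : algebraMap ℂ[X] (RatFunc ℂ) F = aeval g (C c⁻¹ * U) := by
      rw [map_mul, ← hUV, aeval_C, map_inv₀]
      have : algebraMap ℂ (RatFunc ℂ) c ≠ 0 := by simpa using hc0
      field_simp
    set U' := C c⁻¹ * U with hU'
    have hUdeg : 1 ≤ U'.natDegree := by
      by_contra hlt
      obtain ⟨d, hd⟩ : ∃ d, U' = C d := ⟨_, eq_C_of_natDegree_eq_zero (by omega)⟩
      rw [hd, aeval_C] at hUV'
      have : F = C d := by
        apply RatFunc.algebraMap_injective ℂ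
        rw [hUV']; simp
      rw [this] at hF
      simp at hF
    have hint : IsIntegral ℂ[X] g := by
      have hlc : U'.leadingCoeff ≠ 0 := by
        intro h0
        rw [leadingCoeff_eq_zero] at h0
        simp [h0] at hUdeg
      refine ⟨(C U'.leadingCoeff⁻¹ * U').map C - C (C U'.leadingCoeff⁻¹ * F), ?_, ?_⟩
      · apply Monic.sub_of_left
        · apply Monic.map
          rw [Monic, leadingCoeff_mul, leadingCoeff_C, inv_mul_cancel₀ hlc]
        · refine degree_C_le.trans_lt ?_
          rw [degree_map, degree_C_mul (inv_ne_zero hlc)]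
          exact natDegree_pos_iff_degree_pos.1 hUdeg
      · have h1 : (algebraMap ℂ[X] (RatFunc ℂ)).comp C = algebraMap ℂ (RatFunc ℂ) := by
          ext; simp
        rw [eval₂_sub, eval₂_map, eval₂_C, h1, eval₂_mul, eval₂_C, map_mul, hUV', aeval_def]
        simp
    obtain ⟨h, hh⟩ := IsIntegrallyClosed.isIntegral_iff.1 hint
    exact ⟨h, by rw [hh]⟩

theorem exists_eq_comp_of_mem_adjoin_simple (h F : ℂ[X]) (hh : 1 ≤ h.natDegree)
    (hF : algebraMap ℂ[X] (RatFunc ℂ) F ∈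
      IntermediateField.adjoin ℂ {algebraMap ℂ[X] (RatFunc ℂ) h}) :
    ∃ F' : ℂ[X], F = F'.comp h := by
  obtain ⟨U, V, hco, -, hUV⟩ := exists_isCoprime_of_mem_adjoin_simple _ _ hF
  have hcomp : ∀ p : ℂ[X], aeval (algebraMap ℂ[X] (RatFunc ℂ) h) p =
      algebraMap ℂ[X] (RatFunc ℂ) (p.comp h) := by
    intro p
    rw [aeval_algebraMap_apply, comp_eq_aeval]
  rw [hcomp, hcomp, ← map_mul] at hUV
  have hUV' := RatFunc.algebraMap_injective ℂ hUV
  have hdeg : V.degree = 0 := by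
    by_contra hne
    obtain ⟨v, hv⟩ := IsAlgClosed.exists_root V hne
    obtain ⟨a, ha⟩ := IsAlgClosed.exists_root (h - C v) (by
      have : 0 < (h - C v).natDegree := by rw [natDegree_sub_C]; omega
      exact (natDegree_pos_iff_degree_pos.1 this).ne')
    have ha' : h.eval a = v := by simpa [sub_eq_zero] using ha
    obtain ⟨r, s, hrs⟩ := hco
    have h1 := congrArg (eval a) hUV'
    have h2 := congrArg (eval v) hrs
    have hv' : V.eval v = 0 := hv
    simp only [eval_mul, eval_comp, ha', hv', mul_zero] at h1
    simp [← h1, hv'] at h2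
  obtain ⟨c, hc⟩ : ∃ c, V = C c := ⟨_, eq_C_of_degree_eq_zero hdeg⟩
  have hc0 : c ≠ 0 := by
    rintro rfl
    simp [hc] at hdeg
  refine ⟨C c⁻¹ * U, ?_⟩
  rw [mul_comp, ← hUV', hc, C_comp, C_comp, mul_left_comm, ← C_mul, inv_mul_cancel₀ hc0]
  simp

/-- Apart from finitely many points, the map `z ↦ (P(z), Q(z))` is injective. -/
def GenericallyInjective (P Q : ℂ[X]) : Prop :=
  ∃ D : ℂ[X], D ≠ 0 ∧ ∀ z w, D.eval z ≠ 0 → D.eval w ≠ 0 →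
    P.eval z = P.eval w → Q.eval z = Q.eval w → z = w

theorem exists_common_right_factor_or_genericallyInjective (P Q : ℂ[X]) (hP : 1 ≤ P.natDegree) :
    (∃ h P' Q' : ℂ[X], 2 ≤ h.natDegree ∧ P = P'.comp h ∧ Q = Q'.comp h) ∨
      GenericallyInjective P Q := by
  set a := algebraMap ℂ[X] (RatFunc ℂ) with ha
  set E := IntermediateField.adjoin ℂ {a P, a Q} with hE
  have hPE : a P ∈ E := IntermediateField.subset_adjoin _ _ (by simp)
  have hQE : a Q ∈ E := IntermediateField.subset_adjoin _ _ (by simp)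
  obtain ⟨h, hh⟩ := exists_polynomial_generator (RatFunc.Luroth.generator E) P hP
    (by rw [← RatFunc.Luroth.eq_adjoin_generator]; exact hPE)
  rw [← RatFunc.Luroth.eq_adjoin_generator] at hh
  have hdeg : 1 ≤ h.natDegree := by
    by_contra hlt
    obtain ⟨d, hd⟩ : ∃ d, h = C d := ⟨_, eq_C_of_natDegree_eq_zero (by omega)⟩
    rw [← hh, hd] at hPE
    have hbot : IntermediateField.adjoin ℂ {algebraMap ℂ[X] (RatFunc ℂ) (C d)} = ⊥ := by
      rw [IntermediateField.adjoin_simple_eq_bot_iff]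
      exact ⟨d, by simp⟩
    rw [hbot, IntermediateField.mem_bot] at hPE
    obtain ⟨c, hc⟩ := hPE
    have : P = C c := by
      apply RatFunc.algebraMap_injective ℂ
      rw [← ha, ← hc]; simp [ha]
    rw [this] at hP
    simp at hP
  rw [← hh] at hPE hQE
  obtain ⟨P', hP'⟩ := exists_eq_comp_of_mem_adjoin_simple h P hdeg hPE
  obtain ⟨Q', hQ'⟩ := exists_eq_comp_of_mem_adjoin_simple h Q hdeg hQE
  by_cases h2 : 2 ≤ h.natDegree
  · exact Or.inl ⟨h, P', Q', h2, hP', hQ'⟩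
  right
  have h1 : h.natDegree = 1 := by omega
  obtain ⟨c, d, hc, hcd⟩ : ∃ c d : ℂ, c ≠ 0 ∧ h = C c * X + C d := by
    refine ⟨h.coeff 1, h.coeff 0, ?_, eq_X_add_C_of_natDegree_le_one h1.le⟩
    rw [← h1, coeff_natDegree, Ne, leadingCoeff_eq_zero]
    rintro rfl
    simp at h1
  have hmem : a h ∈ E := by rw [← hh]; exact IntermediateField.mem_adjoin_simple_self _ _
  rw [hE, IntermediateField.mem_adjoin_iff_div] at hmem
  obtain ⟨r, hr, s, hs, hrs⟩ := hmem
  have key : ∀ x ∈ Algebra.adjoin ℂ {a P, a Q}, ∃ p : ℂ[X], a p = x ∧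
      ∀ z w, P.eval z = P.eval w → Q.eval z = Q.eval w → p.eval z = p.eval w := by
    intro x hx
    induction hx using Algebra.adjoin_induction with
    | mem x hx =>
      rcases hx with rfl | rfl
      · exact ⟨P, rfl, fun _ _ h _ => h⟩
      · exact ⟨Q, rfl, fun _ _ _ h => h⟩
    | algebraMap c => exact ⟨C c, by simp [ha], by simp⟩
    | add x y _ _ hx hy =>
      obtain ⟨p, rfl, hp⟩ := hx
      obtain ⟨q, rfl, hq⟩ := hy
      exact ⟨p + q, map_add _ _ _, fun z w h1 h2 => by simp [hp z w h1 h2, hq z w h1 h2]⟩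
    | mul x y _ _ hx hy =>
      obtain ⟨p, rfl, hp⟩ := hx
      obtain ⟨q, rfl, hq⟩ := hy
      exact ⟨p * q, map_mul _ _ _, fun z w h1 h2 => by simp [hp z w h1 h2, hq z w h1 h2]⟩
  obtain ⟨p, rfl, hp⟩ := key r hr
  obtain ⟨q, rfl, hq⟩ := key s hs
  have hq0 : q ≠ 0 := by
    rintro rfl
    rw [map_zero, div_zero] at hrs
    have : h = 0 := RatFunc.algebraMap_injective ℂ (by rw [← ha, hrs, map_zero])
    simp [this] at h1
  have hpq : h * q = p := by
    apply RatFunc.algebraMap_injective ℂ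
    have : a q ≠ 0 := RatFunc.algebraMap_ne_zero hq0
    rw [map_mul, ← ha, hrs]
    field_simp
  refine ⟨q, hq0, fun z w hz hw hPzw hQzw => ?_⟩
  have e1 := hp z w hPzw hQzw
  have e2 := hq z w hPzw hQzw
  rw [← hpq, eval_mul, eval_mul, e2] at e1
  have e3 := mul_right_cancel₀ hw e1
  rw [hcd] at e3
  simpa [hc] using e3

/-- The equivalence relation generated by the elementary transformations `U ∘ V ↦ V ∘ U`. -/
def ElementaryEquiv : ℂ[X] → ℂ[X] → Prop :=
  Relation.EqvGen fun f g => ∃ U V : ℂ[X], f = U.comp V ∧ g = V.comp U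

namespace ElementaryEquiv

theorem refl (f : ℂ[X]) : ElementaryEquiv f f := Relation.EqvGen.refl f

theorem symm {f g : ℂ[X]} (h : ElementaryEquiv f g) : ElementaryEquiv g f :=
  Relation.EqvGen.symm _ _ h

theorem trans {f g k : ℂ[X]} (h : ElementaryEquiv f g) (h' : ElementaryEquiv g k) :
    ElementaryEquiv f k :=
  Relation.EqvGen.trans _ _ _ h h'

theorem comp_swap (U V : ℂ[X]) : ElementaryEquiv (U.comp V) (V.comp U) :=
  Relation.EqvGen.rel _ _ ⟨U, V, rfl, rfl⟩

theorem natDegree_eq_and_exists_semiconj {f g : ℂ[X]} (h : ElementaryEquiv f g) :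
    f.natDegree = g.natDegree ∧ (1 ≤ f.natDegree →
      (∃ W : ℂ[X], 1 ≤ W.natDegree ∧ W.comp f = g.comp W) ∧
      ∃ W : ℂ[X], 1 ≤ W.natDegree ∧ W.comp g = f.comp W) := by
  induction h with
  | rel f g h =>
    obtain ⟨U, V, rfl, rfl⟩ := h
    rw [natDegree_comp, natDegree_comp, mul_comm]
    refine ⟨rfl, fun h1 => ?_⟩
    have hU := Nat.pos_of_mul_pos_left h1
    have hV := Nat.pos_of_mul_pos_right h1
    exact ⟨⟨V, hV, (comp_assoc _ _ _).symm⟩, ⟨U, hU, (comp_assoc _ _ _).symm⟩⟩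
  | refl f => exact ⟨rfl, fun _ => ⟨⟨X, by simp⟩, ⟨X, by simp⟩⟩⟩
  | symm f g _ ih => exact ⟨ih.1.symm, fun h1 => (ih.2 (ih.1 ▸ h1)).symm⟩
  | trans f g k _ _ ih ih' =>
    refine ⟨ih.1.trans ih'.1, fun h1 => ?_⟩
    obtain ⟨⟨W, hW, e⟩, W', hW', e'⟩ := ih.2 h1
    obtain ⟨⟨Z, hZ, d⟩, Z', hZ', d'⟩ := ih'.2 (ih.1 ▸ h1)
    refine ⟨⟨Z.comp W, ?_, ?_⟩, ⟨W'.comp Z', ?_, ?_⟩⟩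
    · rw [natDegree_comp]; exact Nat.mul_pos hZ hW
    · rw [comp_assoc, e, ← comp_assoc, d, comp_assoc]
    · rw [natDegree_comp]; exact Nat.mul_pos hW' hZ'
    · rw [comp_assoc, d', ← comp_assoc, e', comp_assoc]

theorem natDegree_eq {f g : ℂ[X]} (h : ElementaryEquiv f g) : f.natDegree = g.natDegree :=
  h.natDegree_eq_and_exists_semiconj.1

theorem exists_semiconj {f g : ℂ[X]} (h : ElementaryEquiv f g) (hf : 1 ≤ f.natDegree) :
    ∃ W : ℂ[X], 1 ≤ W.natDegree ∧ W.comp f = g.comp W :=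
  (h.natDegree_eq_and_exists_semiconj.2 hf).1

theorem of_linear_semiconj {A B : ℂ[X]} {a : ℂ} (b : ℂ) (ha : a ≠ 0)
    (h : (C a * X + C b).comp B = A.comp (C a * X + C b)) : ElementaryEquiv A B := by
  set W : ℂ[X] := C a * X + C b with hW
  set W' : ℂ[X] := C a⁻¹ * X - C (a⁻¹ * b) with hW'
  have h1 : W.comp W' = X := by
    simp only [hW, hW', add_comp, mul_comp, C_comp, X_comp, mul_sub, ← mul_assoc, ← C_mul,
      mul_inv_cancel₀ ha]
    simp
  have h2 : W'.comp W = X := by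
    simp only [hW, hW', sub_comp, mul_comp, C_comp, X_comp, mul_add, ← mul_assoc, ← C_mul,
      inv_mul_cancel₀ ha]
    simp
  have hA : A = (W.comp B).comp W' := by rw [h, comp_assoc, h1, comp_X]
  have hB : B = W'.comp (W.comp B) := by rw [← comp_assoc, h2, X_comp]
  have h3 := comp_swap (W.comp B) W'
  rwa [← hA, ← hB] at h3

end ElementaryEquiv

theorem comp_right_cancel {p q h : ℂ[X]} (hh : 1 ≤ h.natDegree) (e : p.comp h = q.comp h) :
    p = q := by
  rw [← sub_eq_zero, ← sub_comp, comp_eq_zero_iff] at e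
  rcases e with e | ⟨-, e⟩
  · exact sub_eq_zero.1 e
  · rw [e] at hh
    simp at hh

theorem exists_genericallyInjective_semiconj (A : ℂ[X]) : ∀ (m : ℕ) (B P : ℂ[X]),
    P.natDegree = m → 1 ≤ m → P.comp B = A.comp P →
    ∃ B₀ P₀ : ℂ[X], ElementaryEquiv B B₀ ∧ 1 ≤ P₀.natDegree ∧ P₀.comp B₀ = A.comp P₀ ∧
      GenericallyInjective P₀ B₀ := by
  intro m
  induction m using Nat.strong_induction_on with
  | _ m ih =>
    intro B P hm h1 hPB
    rcases exists_common_right_factor_or_genericallyInjective P B (hm ▸ h1) with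
      ⟨h, P', B', hh, rfl, rfl⟩ | hinj
    · have hdeg := hm
      rw [natDegree_comp] at hdeg
      have hP' : 1 ≤ P'.natDegree := by
        rcases Nat.eq_zero_or_pos P'.natDegree with h0 | h0
        · rw [h0] at hdeg; omega
        · exact h0
      have hlt : P'.natDegree < m := by rw [← hdeg]; nlinarith
      have e : P'.comp (h.comp B') = A.comp P' := by
        apply comp_right_cancel (h := h) (by omega)
        simpa only [comp_assoc] using hPB
      obtain ⟨B₀, P₀, h2, h3⟩ := ih _ hlt (h.comp B') P' rfl hP' e
      exact ⟨B₀, P₀, (ElementaryEquiv.comp_swap B' h).trans h2, h3⟩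
    · exact ⟨B, P, ElementaryEquiv.refl B, hm ▸ h1, hPB, hinj⟩

theorem GenericallyInjective.comp {P₁ P₂ B₁ B₂ : ℂ[X]} (h₁ : GenericallyInjective P₁ B₁)
    (h₂ : GenericallyInjective P₂ B₂) (hP₂ : 1 ≤ P₂.natDegree)
    (e : P₂.comp B₂ = B₁.comp P₂) : GenericallyInjective (P₁.comp P₂) B₂ := by
  obtain ⟨D₁, hD₁, H₁⟩ := h₁
  obtain ⟨D₂, hD₂, H₂⟩ := h₂
  refine ⟨D₁.comp P₂ * D₂, mul_ne_zero ?_ hD₂, fun z w hz hw hP hB => ?_⟩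
  · intro h0
    exact hD₁ (comp_right_cancel hP₂ (h0.trans (zero_comp).symm))
  · rw [eval_mul, eval_comp] at hz hw
    rw [eval_comp, eval_comp] at hP
    have e' := fun x => congrArg (eval x) e
    simp only [eval_comp] at e'
    exact H₂ z w (right_ne_zero_of_mul hz) (right_ne_zero_of_mul hw)
      (H₁ _ _ (left_ne_zero_of_mul hz) (left_ne_zero_of_mul hw) hP
        (by rw [← e', ← e', hB])) hB

theorem exists_genericallyInjective_semiconj_step {A B Y C : ℂ[X]} (hA : 1 ≤ A.natDegree)
    (hAB : ¬ ElementaryEquiv A B) (hY : 1 ≤ Y.natDegree) (hYB : Y.comp B = A.comp Y)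
    (hC : ElementaryEquiv A C) :
    ∃ D P : ℂ[X], ElementaryEquiv B D ∧ 2 ≤ P.natDegree ∧ P.comp D = C.comp P ∧
      GenericallyInjective P D := by
  obtain ⟨W, hW, e⟩ := hC.exists_semiconj hA
  obtain ⟨D, P, hD, hP, hPD, hinj⟩ := exists_genericallyInjective_semiconj C _ B (W.comp Y) rfl
    (by rw [natDegree_comp]; exact Nat.mul_pos hW hY)
    (by rw [comp_assoc, hYB, ← comp_assoc, e, comp_assoc])
  refine ⟨D, P, hD, ?_, hPD, hinj⟩
  by_contra hlt
  have h1 : P.natDegree = 1 := by omega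
  have hP' := eq_X_add_C_of_natDegree_le_one h1.le
  have hlc : P.coeff 1 ≠ 0 := by
    rw [← h1, coeff_natDegree, Ne, leadingCoeff_eq_zero]
    rintro rfl
    simp at h1
  rw [hP'] at hPD
  exact hAB (hC.trans ((ElementaryEquiv.of_linear_semiconj _ hlc hPD).trans hD.symm))

theorem exists_genericallyInjective_semiconj_of_large_degree {A B P Q : ℂ[X]}
    (hA : 1 ≤ A.natDegree) (hB : 1 ≤ B.natDegree) (hAB : ¬ ElementaryEquiv A B)
    (hP : 1 ≤ P.natDegree) (hQ : 1 ≤ Q.natDegree)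
    (hPB : P.comp B = A.comp P) (hQA : Q.comp A = B.comp Q) (k : ℕ) :
    ∃ D R : ℂ[X], 2 ^ (k + 1) ≤ R.natDegree ∧ R.comp D = A.comp R ∧
      GenericallyInjective R D ∧ (ElementaryEquiv A D ∨ ElementaryEquiv B D) := by
  induction k with
  | zero =>
    obtain ⟨D, R, h1, h2, h3, h4⟩ :=
      exists_genericallyInjective_semiconj_step hA hAB hP hPB (ElementaryEquiv.refl A)
    exact ⟨D, R, by simpa using h2, h3, h4, Or.inr h1⟩
  | succ k ih =>
    obtain ⟨D, R, h2, h3, h4, h1⟩ := ih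
    obtain ⟨E, S, hE, hS, hSE, hinj⟩ : ∃ E S : ℂ[X],
        (ElementaryEquiv A E ∨ ElementaryEquiv B E) ∧ 2 ≤ S.natDegree ∧ S.comp E = D.comp S ∧
        GenericallyInjective S E := by
      rcases h1 with h1 | h1
      · obtain ⟨E, S, h, h'⟩ := exists_genericallyInjective_semiconj_step hA hAB hP hPB h1
        exact ⟨E, S, Or.inr h, h'⟩
      · obtain ⟨E, S, h, h'⟩ :=
          exists_genericallyInjective_semiconj_step hB (fun h => hAB h.symm) hQ hQA h1
        exact ⟨E, S, Or.inl h, h'⟩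
    refine ⟨E, R.comp S, ?_, ?_, h4.comp hinj (by omega) hSE, hE⟩
    · rw [natDegree_comp, pow_succ]
      exact Nat.mul_le_mul h2 hS
    · rw [comp_assoc, hSE, ← comp_assoc, h3, comp_assoc]

/-- The multiset of critical values of a polynomial. -/
noncomputable def criticalValues (P : ℂ[X]) : Multiset ℂ :=
  (derivative P).roots.map fun z => P.eval z

/-- The finite set of preimages of a point under a polynomial. -/
noncomputable def fiber (P : ℂ[X]) (t : ℂ) : Finset ℂ :=
  (P - C t).roots.toFinset

theorem sub_C_ne_zero {P : ℂ[X]} (hP : 1 ≤ P.natDegree) (t : ℂ) : P - C t ≠ 0 := by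
  intro h
  rw [sub_eq_zero.1 h] at hP
  simp at hP

theorem mem_roots_sub_C_iff {P : ℂ[X]} (hP : 1 ≤ P.natDegree) {t z : ℂ} :
    z ∈ (P - C t).roots ↔ P.eval z = t := by
  rw [mem_roots (sub_C_ne_zero hP t), IsRoot.def, eval_sub, eval_C, sub_eq_zero]

theorem mem_fiber {P : ℂ[X]} (hP : 1 ≤ P.natDegree) {t z : ℂ} :
    z ∈ fiber P t ↔ P.eval z = t := by
  rw [fiber, Multiset.mem_toFinset, mem_roots_sub_C_iff hP]

theorem card_roots_sub_C_eq (P : ℂ[X]) (t : ℂ) :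
    Multiset.card (P - C t).roots = P.natDegree := by
  rw [← (IsAlgClosed.splits (P - C t)).natDegree_eq_card_roots, natDegree_sub_C]

theorem derivative_ne_zero {P : ℂ[X]} (hP : 1 ≤ P.natDegree) : derivative P ≠ 0 := by
  intro h
  rw [Polynomial.derivative_eq_zero.1 h] at hP
  omega

theorem card_criticalValues (P : ℂ[X]) :
    Multiset.card (criticalValues P) = P.natDegree - 1 := by
  rw [criticalValues, Multiset.card_map,
    ← (IsAlgClosed.splits (derivative P)).natDegree_eq_card_roots, natDegree_derivative]

theorem rootMultiplicity_derivative_add_one {P : ℂ[X]} (hP : 1 ≤ P.natDegree) {t z : ℂ}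
    (hz : P.eval z = t) :
    rootMultiplicity z (derivative P) + 1 = rootMultiplicity z (P - C t) := by
  have hroot : (P - C t).IsRoot z := by simp [hz]
  have h1 := derivative_rootMultiplicity_of_root hroot
  have h2 := (rootMultiplicity_pos (sub_C_ne_zero hP t)).2 hroot
  rw [derivative_sub, derivative_C, sub_zero] at h1
  omega

theorem card_fiber_add_count_criticalValues {P : ℂ[X]} (hP : 1 ≤ P.natDegree) (t : ℂ) :
    (fiber P t).card + (criticalValues P).count t = P.natDegree := by
  classical
  have h1 : (criticalValues P).count t =
      ∑ z ∈ fiber P t, rootMultiplicity z (derivative P) := by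
    rw [criticalValues, Multiset.count_map, ← Multiset.sum_count_eq_card (s := fiber P t)]
    · refine Finset.sum_congr rfl fun z hz => ?_
      rw [Multiset.count_filter_of_pos (p := fun a => t = P.eval a) ((mem_fiber hP).1 hz).symm,
        count_roots]
    · intro z hz
      exact (mem_fiber hP).2 (Multiset.mem_filter.1 hz).2.symm
  have h2 : P.natDegree = ∑ z ∈ fiber P t, (rootMultiplicity z (derivative P) + 1) := by
    rw [← card_roots_sub_C_eq P t, ← Multiset.toFinset_sum_count_eq]
    refine Finset.sum_congr rfl fun z hz => ?_
    rw [count_roots, rootMultiplicity_derivative_add_one hP ((mem_fiber hP).1 hz)]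
  rw [h1, h2, Finset.sum_add_distrib, Finset.sum_const, smul_eq_mul, mul_one, add_comm]

theorem nodup_roots_sub_C {P : ℂ[X]} (hP : 1 ≤ P.natDegree) {t : ℂ}
    (h : ∀ z, P.eval z = t → (derivative P).eval z ≠ 0) : (P - C t).roots.Nodup := by
  classical
  rw [Multiset.nodup_iff_count_le_one]
  intro z
  by_cases hz : P.eval z = t
  · rw [count_roots, ← rootMultiplicity_derivative_add_one hP hz,
      rootMultiplicity_eq_zero (h z hz)]
  · rw [Multiset.count_eq_zero_of_notMem]
    · exact zero_le_one
    · rwa [mem_roots_sub_C_iff hP]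

theorem exists_eval_eq_prod_roots_map (P B : ℂ[X]) (hP : 1 ≤ P.natDegree) (y : ℂ) :
    ∃ G : ℂ[X], ∀ p : ℂ,
      G.eval p = ((P - C p).roots.map fun z => y - B.eval z).prod := by
  set g := C y - B with hg
  set n := g.natDegree
  have hlc : P.leadingCoeff ^ n ≠ 0 := by
    apply pow_ne_zero
    rw [Ne, leadingCoeff_eq_zero]
    rintro rfl
    simp at hP
  refine ⟨C ((P.leadingCoeff ^ n)⁻¹ * ((-1) ^ (P.natDegree * n) *
    g.leadingCoeff ^ P.natDegree)) * (g.roots.map fun w => C (P.eval w) - X).prod, fun p => ?_⟩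
  have h1 := resultant_eq_prod_eval (P - C p) g n le_rfl (IsAlgClosed.splits _)
  have h2 := resultant_eq_prod_eval g (P - C p) P.natDegree (by rw [natDegree_sub_C])
    (IsAlgClosed.splits _)
  have hlcp : (P - C p).leadingCoeff = P.leadingCoeff := by
    apply leadingCoeff_sub_of_degree_lt
    exact degree_C_le.trans_lt (natDegree_pos_iff_degree_pos.1 hP)
  rw [natDegree_sub_C, resultant_comm, h2, hlcp] at h1
  rw [eval_mul, eval_C, eval_multiset_prod, Multiset.map_map]
  simp only [Function.comp_def, eval_sub, eval_C, eval_X, hg] at h1 ⊢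
  rw [mul_assoc, mul_assoc, inv_mul_eq_iff_eq_mul₀ hlc]
  exact h1

theorem map_roots_sub_C_of_genericallyInjective {A B P : ℂ[X]} (hA : 1 ≤ A.natDegree)
    (hP : 1 ≤ P.natDegree) (e : P.comp B = A.comp P) (hinj : GenericallyInjective P B) (p : ℂ) :
    (P - C p).roots.map (fun z => B.eval z) = (P - C (A.eval p)).roots := by
  classical
  obtain ⟨D, hD, hinj⟩ := hinj
  have e' : ∀ x, P.eval (B.eval x) = A.eval (P.eval x) := fun x => by
    simpa only [eval_comp] using congrArg (eval x) e
  have hP' := derivative_ne_zero hP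
  have hlc : P.leadingCoeff ≠ 0 := by
    rw [Ne, leadingCoeff_eq_zero]
    rintro rfl
    simp at hP
  set bad : Set ℂ := ((D * derivative P).roots.toFinset.image fun z => P.eval z) ∪
    ⋃ w ∈ (derivative P).roots.toFinset, (fiber A (P.eval w) : Set ℂ) with hbad
  have hfin : bad.Finite := by
    apply Set.Finite.union (Finset.finite_toSet _)
    exact Set.Finite.biUnion (Finset.finite_toSet _) fun w _ => Finset.finite_toSet _
  have hgood : ∀ p ∈ badᶜ, (P - C p).roots.map (fun z => B.eval z) =
      (P - C (A.eval p)).roots := by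
    intro p hp
    rw [hbad, Set.mem_compl_iff, Set.mem_union, not_or] at hp
    obtain ⟨hp1, hp2⟩ := hp
    have h1 : ∀ z, P.eval z = p → D.eval z ≠ 0 ∧ (derivative P).eval z ≠ 0 := by
      intro z hz
      rw [← mul_ne_zero_iff, ← eval_mul]
      intro h0
      apply hp1
      rw [Finset.mem_coe, Finset.mem_image]
      exact ⟨z, by rw [Multiset.mem_toFinset, mem_roots (mul_ne_zero hD hP')]; exact h0, hz⟩
    have h2 : ∀ w, P.eval w = A.eval p → (derivative P).eval w ≠ 0 := by
      intro w hw h0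
      apply hp2
      simp only [Set.mem_iUnion]
      refine ⟨w, by rw [Multiset.mem_toFinset, mem_roots hP']; exact h0, ?_⟩
      rw [Finset.mem_coe, mem_fiber hA, hw]
    apply Multiset.eq_of_le_of_card_le
    · rw [Multiset.le_iff_subset]
      · intro q hq
        obtain ⟨z, hz, rfl⟩ := Multiset.mem_map.1 hq
        rw [mem_roots_sub_C_iff hP] at hz ⊢
        rw [e', hz]
      · refine Multiset.Nodup.map_on ?_ (nodup_roots_sub_C hP fun z hz => (h1 z hz).2)
        intro z hz w hw hzw
        rw [mem_roots_sub_C_iff hP] at hz hw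
        exact hinj z w (h1 z hz).1 (h1 w hw).1 (hz.trans hw.symm) hzw
    · rw [Multiset.card_map, card_roots_sub_C_eq, card_roots_sub_C_eq]
  have hprod : ∀ t y : ℂ, ((P - C t).roots.map fun w => y - w).prod =
      P.leadingCoeff⁻¹ * (P.eval y - t) := by
    intro t y
    have hlcp : (P - C t).leadingCoeff = P.leadingCoeff := by
      apply leadingCoeff_sub_of_degree_lt
      exact degree_C_le.trans_lt (natDegree_pos_iff_degree_pos.1 hP)
    have h1 := (IsAlgClosed.splits (P - C t)).eval_eq_prod_roots y
    rw [hlcp, eval_sub, eval_C] at h1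
    rw [h1, inv_mul_cancel_left₀ hlc]
  have key : ∀ y : ℂ, ((P - C p).roots.map fun z => y - B.eval z).prod =
      ((P - C (A.eval p)).roots.map fun w => y - w).prod := by
    intro y
    obtain ⟨G, hG⟩ := exists_eval_eq_prod_roots_map P B hP y
    have hGH : G = C P.leadingCoeff⁻¹ * (C (P.eval y) - A) := by
      apply eq_of_infinite_eval_eq
      refine hfin.infinite_compl.mono fun p hp => ?_
      rw [Set.mem_ofPred_eq, hG, eval_mul, eval_C, eval_sub, eval_C, ← hprod, ← hgood p hp,
        Multiset.map_map]
      rfl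
    rw [← hG, hGH, hprod, eval_mul, eval_C, eval_sub, eval_C]
  have hpoly : (((P - C p).roots.map fun z => B.eval z).map fun a => X - C a).prod =
      ((P - C (A.eval p)).roots.map fun a => X - C a).prod := by
    apply Polynomial.funext
    intro y
    rw [eval_multiset_prod, eval_multiset_prod, Multiset.map_map, Multiset.map_map,
      Multiset.map_map]
    simpa [Function.comp_def] using key y
  have := congrArg roots hpoly
  rwa [roots_multiset_prod_X_sub_C, roots_multiset_prod_X_sub_C] at this

theorem rootMultiplicity_le_mul_of_semiconj {A B P : ℂ[X]} (hA : 1 ≤ A.natDegree)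
    (hP : 1 ≤ P.natDegree) (e : P.comp B = A.comp P) (z : ℂ) :
    rootMultiplicity (B.eval z) (P - C (P.eval (B.eval z))) ≤
      rootMultiplicity (P.eval z) (A - C (A.eval (P.eval z))) *
        rootMultiplicity z (P - C (P.eval z)) := by
  have e' : P.eval (B.eval z) = A.eval (P.eval z) := by
    simpa only [eval_comp] using congrArg (eval z) e
  set t := A.eval (P.eval z) with ht
  rw [e']
  set p := P.eval z with hp
  have hAP : (A - C t).comp P ≠ 0 := by
    intro h0
    exact sub_C_ne_zero hA t (comp_right_cancel hP (h0.trans zero_comp.symm))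
  obtain ⟨g, hg, hgp⟩ := exists_eq_pow_rootMultiplicity_mul_and_not_dvd _ (sub_C_ne_zero hA t) p
  set m := rootMultiplicity p (A - C t)
  have h1 : (A - C t).comp P = (P - C p) ^ m * g.comp P := by
    rw [hg, mul_comp, pow_comp, sub_comp, X_comp, C_comp]
  have h2 : rootMultiplicity z ((A - C t).comp P) = m * rootMultiplicity z (P - C p) := by
    have hgz : rootMultiplicity z (g.comp P) = 0 := by
      apply rootMultiplicity_eq_zero
      rw [IsRoot.def, eval_comp, ← hp]
      exact fun h0 => hgp (dvd_iff_isRoot.2 h0)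
    rw [h1] at hAP ⊢
    rw [rootMultiplicity_mul hAP, hgz, add_zero, ← count_roots, roots_pow, Multiset.count_nsmul,
      count_roots]
  rw [← h2, le_rootMultiplicity_iff hAP, sub_comp, ← e, C_comp]
  have h3 : (X - C (B.eval z)) ^ rootMultiplicity (B.eval z) (P - C t) ∣ P - C t :=
    pow_rootMultiplicity_dvd _ _
  have h4 := map_dvd (compRingHom B) h3
  simp only [coe_compRingHom_apply, pow_comp, sub_comp, X_comp, C_comp] at h4
  refine (pow_dvd_pow_of_dvd ?_ _).trans h4
  rw [dvd_iff_isRoot]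
  simp

theorem card_fiber_le_mul {A B P : ℂ[X]} (hA : 1 ≤ A.natDegree)
    (hP : 1 ≤ P.natDegree) (e : P.comp B = A.comp P) (hinj : GenericallyInjective P B) (p : ℂ) :
    (fiber P p).card ≤
      rootMultiplicity p (A - C (A.eval p)) * (fiber P (A.eval p)).card := by
  classical
  have e' : ∀ x, P.eval (B.eval x) = A.eval (P.eval x) := fun x => by
    simpa only [eval_comp] using congrArg (eval x) e
  refine Finset.card_le_mul_card_image_of_maps_to (f := fun z => B.eval z) ?_ _ ?_
  · intro z hz
    rw [mem_fiber hP] at hz ⊢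
    rw [e', hz]
  · intro q hq
    rw [mem_fiber hP] at hq
    have hpos : 0 < rootMultiplicity q (P - C (A.eval p)) := by
      rw [rootMultiplicity_pos (sub_C_ne_zero hP _)]
      simp [hq]
    have hsum : rootMultiplicity q (P - C (A.eval p)) =
        ∑ z ∈ (fiber P p).filter (fun z => B.eval z = q), rootMultiplicity z (P - C p) := by
      rw [← count_roots, ← map_roots_sub_C_of_genericallyInjective hA hP e hinj,
        Multiset.count_map,
        ← Multiset.sum_count_eq_card (s := (fiber P p).filter (fun z => B.eval z = q))]
      · refine Finset.sum_congr rfl fun z hz => ?_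
        rw [Multiset.count_filter_of_pos (p := fun a => q = B.eval a) (Finset.mem_filter.1 hz).2.symm,
          count_roots]
      · intro z hz
        rw [Multiset.mem_filter] at hz
        rw [Finset.mem_filter, fiber, Multiset.mem_toFinset]
        exact ⟨hz.1, hz.2.symm⟩
    refine Nat.le_of_mul_le_mul_right ?_ hpos
    calc
      _ = ∑ z ∈ (fiber P p).filter (fun z => B.eval z = q),
          rootMultiplicity q (P - C (A.eval p)) := by rw [Finset.sum_const, smul_eq_mul]
      _ ≤ ∑ z ∈ (fiber P p).filter (fun z => B.eval z = q),
          rootMultiplicity p (A - C (A.eval p)) * rootMultiplicity z (P - C p) := by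
        refine Finset.sum_le_sum fun z hz => ?_
        rw [Finset.mem_filter, mem_fiber hP] at hz
        obtain ⟨rfl, rfl⟩ := hz
        have := rootMultiplicity_le_mul_of_semiconj hA hP e z
        rwa [e'] at this
      _ = _ := by rw [← Finset.mul_sum, ← hsum]

theorem mem_criticalValues_iff {P : ℂ[X]} (hP : 1 ≤ P.natDegree) {t : ℂ} :
    t ∈ criticalValues P ↔ (fiber P t).card < P.natDegree := by
  have := card_fiber_add_count_criticalValues hP t
  rw [← Multiset.count_pos]
  omega

/-- Preimages of a set of `k` points under a polynomial of degree `n` number at least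
`n * k - (n - 1)`. -/
theorem mul_card_le_card_biUnion_fiber {A : ℂ[X]} (hA : 1 ≤ A.natDegree) (S : Finset ℂ) :
    A.natDegree * S.card ≤ (S.biUnion (fiber A)).card + (A.natDegree - 1) := by
  have hdisj : (S : Set ℂ).PairwiseDisjoint (fiber A) := by
    intro s _ t _ hst
    refine Finset.disjoint_left.2 fun z hs ht => hst ?_
    rw [← (mem_fiber hA).1 hs, (mem_fiber hA).1 ht]
  have hle : ∑ t ∈ S, (criticalValues A).count t ≤ A.natDegree - 1 := by
    rw [← card_criticalValues, ← Multiset.toFinset_sum_count_eq]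
    refine Finset.sum_le_sum_of_ne_zero fun t _ ht => ?_
    rwa [Multiset.mem_toFinset, ← Multiset.count_ne_zero]
  have hsum : ∑ t ∈ S, ((fiber A t).card + (criticalValues A).count t) =
      S.card * A.natDegree := by
    rw [Finset.sum_congr rfl fun t _ => card_fiber_add_count_criticalValues hA t,
      Finset.sum_const, smul_eq_mul]
  rw [Finset.sum_add_distrib] at hsum
  rw [Finset.card_biUnion hdisj, mul_comm]
  omega

/-- A polynomial affinely conjugate to a monomial. -/
def PowerType (A : ℂ[X]) : Prop :=
  ∃ t : ℂ, A = C A.leadingCoeff * (X - C t) ^ A.natDegree + C t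

/-- A polynomial satisfying the differential equation of the Chebyshev polynomials, up to an
affine change of variable. -/
def ChebyshevType (A : ℂ[X]) : Prop :=
  ∃ s t : ℂ, s ≠ t ∧ derivative A ^ 2 * ((X - C s) * (X - C t)) =
    C ((A.natDegree : ℂ) ^ 2) * ((A - C s) * (A - C t))

theorem PowerType.of_forall_eval_eq {A : ℂ[X]} (hA : 1 ≤ A.natDegree) {t : ℂ}
    (h : ∀ p, A.eval p = t → p = t) : PowerType A := by
  refine ⟨t, ?_⟩
  have hlc : (A - C t).leadingCoeff = A.leadingCoeff := by
    apply leadingCoeff_sub_of_degree_lt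
    exact degree_C_le.trans_lt (natDegree_pos_iff_degree_pos.1 hA)
  have hroots : (A - C t).roots = Multiset.replicate A.natDegree t := by
    rw [Multiset.eq_replicate]
    exact ⟨card_roots_sub_C_eq A t, fun p hp => h p ((mem_roots_sub_C_iff hA).1 hp)⟩
  have h1 := (IsAlgClosed.splits (A - C t)).eq_prod_roots
  rw [hlc, hroots, Multiset.map_replicate, Multiset.prod_replicate] at h1
  rw [← h1, sub_add_cancel]

theorem ChebyshevType.of_preimages {A : ℂ[X]} (hA : 2 ≤ A.natDegree) {S : Finset ℂ}
    (hS : S.card = 2)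
    (h : ∀ p, A.eval p ∈ S → (derivative A).eval p ≠ 0 → p ∈ S) : ChebyshevType A := by
  have hA1 : 1 ≤ A.natDegree := by omega
  have hA' := derivative_ne_zero hA1
  set W := S.biUnion (fiber A) with hW
  have hmemW : ∀ p, p ∈ W ↔ A.eval p ∈ S := by
    intro p
    simp [hW, mem_fiber hA1]
  set Z := W.filter fun p => (derivative A).eval p = 0
  set N := W.filter fun p => ¬ (derivative A).eval p = 0
  have hcard : Z.card + N.card = W.card := Finset.card_filter_add_card_filter_not _
  have hWcard := mul_card_le_card_biUnion_fiber hA1 S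
  have hNS : N ⊆ S := fun p hp => by
    obtain ⟨hp1, hp2⟩ := Finset.mem_filter.1 hp
    exact h p ((hmemW p).1 hp1) hp2
  have hZ : Z ⊆ (derivative A).roots.toFinset := fun p hp => by
    rw [Multiset.mem_toFinset, mem_roots hA']
    exact (Finset.mem_filter.1 hp).2
  have hroots : Multiset.card (derivative A).roots = A.natDegree - 1 := by
    rw [← (IsAlgClosed.splits (derivative A)).natDegree_eq_card_roots, natDegree_derivative]
  have hNc := Finset.card_le_card hNS
  have hZc := Finset.card_le_card hZ
  have hZr := Multiset.toFinset_card_le (derivative A).roots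
  rw [← hW, hS] at hWcard
  have hN : N = S := Finset.eq_of_subset_of_card_le hNS (by omega)
  have hZ' : Z = (derivative A).roots.toFinset := Finset.eq_of_subset_of_card_le hZ (by omega)
  have hnodup : (derivative A).roots.Nodup := by
    rw [← Multiset.toFinset_card_eq_card_iff_nodup]
    omega
  obtain ⟨s, t, hst, rfl⟩ := Finset.card_eq_two.1 hS
  refine ⟨s, t, hst, ?_⟩
  have hs : s ∈ N := by simp [hN]
  have ht : t ∈ N := by simp [hN]
  set F := (A - C s) * (A - C t) with hF
  have hF0 : F ≠ 0 := mul_ne_zero (sub_C_ne_zero hA1 s) (sub_C_ne_zero hA1 t)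
  have hst0 : (X - C s) * (X - C t) ≠ 0 := mul_ne_zero (X_sub_C_ne_zero s) (X_sub_C_ne_zero t)
  set G := derivative A ^ 2 * ((X - C s) * (X - C t)) with hG
  have hG0 : G ≠ 0 := mul_ne_zero (pow_ne_zero _ hA') hst0
  have hFroot : ∀ p ∈ W, F.IsRoot p := by
    intro p hp
    have := (hmemW p).1 hp
    rw [Finset.mem_insert, Finset.mem_singleton] at this
    rw [IsRoot.def, hF, eval_mul, eval_sub, eval_sub, eval_C, eval_C, mul_eq_zero, sub_eq_zero,
      sub_eq_zero]
    exact this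
  have hGroots : G.roots = 2 • (derivative A).roots + ({s} + {t}) := by
    rw [hG, roots_mul hG0, roots_mul hst0, roots_pow, roots_X_sub_C, roots_X_sub_C]
  have hle : G.roots ≤ F.roots := by
    rw [Multiset.le_iff_count]
    intro p
    rw [hGroots, Multiset.count_add, Multiset.count_nsmul, Multiset.count_add,
      Multiset.count_singleton, Multiset.count_singleton, count_roots F]
    by_cases hp : p ∈ N
    · have hp0 := (Finset.mem_filter.1 hp).2
      have h1 := (rootMultiplicity_pos hF0).2 (hFroot p (Finset.mem_filter.1 hp).1)
      rw [count_roots, rootMultiplicity_eq_zero hp0]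
      split_ifs with hps hpt
      · exact absurd (hps.symm.trans hpt) hst
      all_goals omega
    · rw [if_neg (ne_of_mem_of_not_mem hs hp).symm, if_neg (ne_of_mem_of_not_mem ht hp).symm]
      by_cases hpr : p ∈ (derivative A).roots
      · rw [Multiset.count_eq_one_of_mem hnodup hpr]
        rw [← Multiset.mem_toFinset, ← hZ', Finset.mem_filter] at hpr
        rw [mul_one, add_zero, add_zero, ← Nat.succ_le_iff.symm]
        refine (one_lt_rootMultiplicity_iff_isRoot hF0).2 ⟨hFroot p hpr.1, ?_⟩
        simp [hF, IsRoot.def, hpr.2]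
      · rw [Multiset.count_eq_zero_of_notMem hpr]
        exact Nat.zero_le _
  have heq : G.roots = F.roots := by
    refine Multiset.eq_of_le_of_card_le hle ?_
    rw [hGroots, hF, roots_mul hF0, Multiset.card_add, Multiset.card_add, Multiset.card_nsmul,
      hroots, card_roots_sub_C_eq, card_roots_sub_C_eq, Multiset.card_add,
      Multiset.card_singleton, Multiset.card_singleton]
    omega
  have hlc : ∀ c : ℂ, (A - C c).leadingCoeff = A.leadingCoeff := fun c =>
    leadingCoeff_sub_of_degree_lt <|
      degree_C_le.trans_lt (natDegree_pos_iff_degree_pos.1 hA1)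
  have hlcG : G.leadingCoeff = (A.natDegree : ℂ) ^ 2 * F.leadingCoeff := by
    rw [hG, hF, leadingCoeff_mul, leadingCoeff_mul, leadingCoeff_mul, leadingCoeff_pow,
      leadingCoeff_X_sub_C, leadingCoeff_X_sub_C, hlc, hlc, leadingCoeff_derivative]
    ring
  have h1 := (IsAlgClosed.splits F).eq_prod_roots
  have h2 := (IsAlgClosed.splits G).eq_prod_roots
  rw [h2, h1, heq, hlcG, C_mul, mul_assoc, ← h1]

theorem powerType_or_chebyshevType {A B P : ℂ[X]} (hA : 2 ≤ A.natDegree)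
    (hP : A.natDegree < P.natDegree) (e : P.comp B = A.comp P)
    (hinj : GenericallyInjective P B) : PowerType A ∨ ChebyshevType A := by
  have hA1 : 1 ≤ A.natDegree := by omega
  have hP1 : 1 ≤ P.natDegree := by omega
  have hA' := derivative_ne_zero hA1
  set S := (criticalValues P).toFinset with hS
  have hmem : ∀ t, t ∈ S ↔ (fiber P t).card < P.natDegree := fun t => by
    rw [hS, Multiset.mem_toFinset, mem_criticalValues_iff hP1]
  have hmult := card_fiber_le_mul hA1 hP1 e hinj
  have hS0 : S.Nonempty := by
    rw [hS, Multiset.toFinset_nonempty, ← Multiset.card_pos, card_criticalValues]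
    omega
  have hback : ∀ p, A.eval p ∈ S → (derivative A).eval p ≠ 0 → p ∈ S := by
    intro p hp hp'
    rw [hmem] at hp ⊢
    have h1 := hmult p
    rw [← rootMultiplicity_derivative_add_one hA1 rfl, rootMultiplicity_eq_zero hp', zero_add,
      one_mul] at h1
    omega
  have hcard : S.card ≤ 2 := by
    have h1 := mul_card_le_card_biUnion_fiber hA1 S
    have h2 : (S.biUnion (fiber A)).card ≤ (S ∪ (derivative A).roots.toFinset).card := by
      refine Finset.card_le_card fun p hp => ?_
      rw [Finset.mem_biUnion] at hp
      obtain ⟨t, ht, hpt⟩ := hp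
      rw [mem_fiber hA1] at hpt
      rw [Finset.mem_union, Multiset.mem_toFinset (s := (derivative A).roots), mem_roots hA']
      by_cases hp' : (derivative A).eval p = 0
      · exact Or.inr hp'
      · exact Or.inl (hback p (hpt ▸ ht) hp')
    have h3 := Finset.card_union_le S (derivative A).roots.toFinset
    have h4 := Multiset.toFinset_card_le (derivative A).roots
    rw [← (IsAlgClosed.splits (derivative A)).natDegree_eq_card_roots, natDegree_derivative] at h4
    by_contra hlt
    obtain ⟨m, hm⟩ : ∃ m, A.natDegree = m + 2 := ⟨A.natDegree - 2, by omega⟩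
    obtain ⟨j, hj⟩ : ∃ j, S.card = j + 3 := ⟨S.card - 3, by omega⟩
    rw [hm, hj] at h1
    have h5 : (m + 2) * (j + 3) = m * j + 3 * m + 2 * j + 6 := by ring
    omega
  rcases (Nat.lt_or_ge S.card 2) with h | h
  · left
    obtain ⟨t, ht⟩ := Finset.card_eq_one.1 (by have := hS0.card_pos; omega : S.card = 1)
    refine PowerType.of_forall_eval_eq hA1 (t := t) fun p hp => ?_
    rw [← Finset.mem_singleton, ← ht, hmem]
    have hcount : (criticalValues P).count t = Multiset.card (criticalValues P) := by
      rw [Multiset.count_eq_card]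
      intro x hx
      have : x ∈ S := Multiset.mem_toFinset.2 hx
      rw [ht, Finset.mem_singleton] at this
      exact this.symm
    have h1 := card_fiber_add_count_criticalValues hP1 t
    rw [hcount, card_criticalValues] at h1
    have h2 : (fiber P t).card = 1 := by omega
    have h3 := hmult p
    rw [hp, h2, mul_one, ← count_roots] at h3
    have h4 := Multiset.count_le_card p (A - C t).roots
    rw [card_roots_sub_C_eq] at h4
    omega
  · exact Or.inr (ChebyshevType.of_preimages hA (le_antisymm hcard h) hback)

theorem natDegree_eq_of_semiconj {A B P : ℂ[X]} (hP : 1 ≤ P.natDegree)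
    (e : P.comp B = A.comp P) : A.natDegree = B.natDegree := by
  have h := congrArg natDegree e
  rw [natDegree_comp, natDegree_comp, mul_comm] at h
  exact (Nat.eq_of_mul_eq_mul_right hP h).symm

theorem PowerType.of_semiconj {A B P : ℂ[X]} (hA : 2 ≤ A.natDegree) (hP : 1 ≤ P.natDegree)
    (e : P.comp B = A.comp P) (h : PowerType A) : PowerType B := by
  obtain ⟨t, ht⟩ := h
  have hBdeg := natDegree_eq_of_semiconj hP e
  have hB : 1 ≤ B.natDegree := by omega
  have hlc : A.leadingCoeff ≠ 0 := by
    rw [Ne, leadingCoeff_eq_zero]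
    rintro rfl
    simp at hA
  have hAt : ∀ p, A.eval p = t → p = t := by
    intro p hp
    rw [ht] at hp
    simp [hlc, sub_eq_zero] at hp
    exact hp.1
  have hback : ∀ p, B.eval p ∈ fiber P t → p ∈ fiber P t := by
    intro p hp
    rw [mem_fiber hP] at hp ⊢
    apply hAt
    rw [← hp]
    simpa only [eval_comp] using (congrArg (eval p) e).symm
  have h1 : ((fiber P t).biUnion (fiber B)).card ≤ (fiber P t).card := by
    refine Finset.card_le_card fun p hp => ?_
    obtain ⟨q, hq, hpq⟩ := Finset.mem_biUnion.1 hp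
    rw [mem_fiber hB] at hpq
    exact hback p (hpq ▸ hq)
  have h2 := mul_card_le_card_biUnion_fiber hB (fiber P t)
  have h3 : (fiber P t).Nonempty := by
    rw [fiber, Multiset.toFinset_nonempty, ← Multiset.card_pos, card_roots_sub_C_eq]
    exact hP
  have h4 : (fiber P t).card = 1 := by
    have := h3.card_pos
    by_contra hne
    obtain ⟨m, hm⟩ : ∃ m, B.natDegree = m + 2 := ⟨B.natDegree - 2, by omega⟩
    obtain ⟨j, hj⟩ : ∃ j, (fiber P t).card = j + 2 := ⟨(fiber P t).card - 2, by omega⟩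
    rw [hm, hj] at h2
    rw [hj] at h1
    have h5 : (m + 2) * (j + 2) = m * j + 2 * m + 2 * j + 4 := by ring
    omega
  obtain ⟨q, hq⟩ := Finset.card_eq_one.1 h4
  refine PowerType.of_forall_eval_eq hB (t := q) fun p hp => ?_
  rw [hq] at hback
  simpa [hp] using hback p

theorem PowerType.elementaryEquiv_X_pow {A : ℂ[X]} (hA : 2 ≤ A.natDegree) (h : PowerType A) :
    ElementaryEquiv A (X ^ A.natDegree) := by
  obtain ⟨t, ht⟩ := h
  have hlc : A.leadingCoeff ≠ 0 := by
    rw [Ne, leadingCoeff_eq_zero]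
    rintro rfl
    simp at hA
  obtain ⟨a, ha⟩ := IsAlgClosed.exists_pow_nat_eq A.leadingCoeff⁻¹
    (by omega : 0 < A.natDegree - 1)
  have ha0 : a ≠ 0 := by
    rintro rfl
    rw [zero_pow (by omega)] at ha
    exact inv_ne_zero hlc ha.symm
  have han : A.leadingCoeff * a ^ A.natDegree = a := by
    obtain ⟨m, hm⟩ : ∃ m, A.natDegree = m + 1 := ⟨A.natDegree - 1, by omega⟩
    rw [hm, Nat.add_sub_cancel] at ha
    rw [hm, pow_succ, ha, mul_inv_cancel_left₀ hlc]
  refine ElementaryEquiv.of_linear_semiconj t ha0 ?_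
  calc
    _ = C a * X ^ A.natDegree + C t := by simp
    _ = (C A.leadingCoeff * (X - C t) ^ A.natDegree + C t).comp (C a * X + C t) := by
      nth_rewrite 1 [← han]
      simp [mul_pow, mul_assoc]
    _ = _ := by rw [← ht]

/-- The differential equation of the Chebyshev polynomials `± T_n`. -/
def ChebyshevEquation (A : ℂ[X]) : Prop :=
  derivative A ^ 2 * (X ^ 2 - 1) = C ((A.natDegree : ℂ) ^ 2) * (A ^ 2 - 1)

theorem ChebyshevType.exists_chebyshevEquation {A : ℂ[X]} (h : ChebyshevType A) :
    ∃ A₁, ElementaryEquiv A A₁ ∧ ChebyshevEquation A₁ := by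
  obtain ⟨s, t, hst, h⟩ := h
  obtain ⟨a, rfl⟩ : ∃ a, s = t + 2 * a := ⟨(s - t) / 2, by ring⟩
  have ha : a ≠ 0 := by
    rintro rfl
    simp at hst
  have hCa : (C a⁻¹ : ℂ[X]) * C a = 1 := by rw [← C_mul, inv_mul_cancel₀ ha, C_1]
  set W : ℂ[X] := C a * X + C (t + a) with hW
  set A₁ := C a⁻¹ * (A.comp W - C (t + a)) with hA₁
  have e : W.comp A₁ = A.comp W := by
    rw [hW, hA₁]
    simp only [add_comp, mul_comp, C_comp, X_comp]
    rw [← mul_assoc, mul_comm (C a), hCa]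
    ring
  have hequiv : ElementaryEquiv A A₁ := ElementaryEquiv.of_linear_semiconj (t + a) ha e
  refine ⟨A₁, hequiv, ?_⟩
  have hd : derivative A₁ = (derivative A).comp W := by
    rw [hA₁, derivative_C_mul, derivative_sub, derivative_C, sub_zero, derivative_comp, hW]
    simp only [derivative_add, derivative_C_mul, derivative_X, derivative_C]
    rw [add_zero, mul_one, ← mul_assoc, hCa, one_mul]
  have h1 := congrArg (fun p => p.comp W) h
  simp only [mul_comp, pow_comp, sub_comp, X_comp, C_comp] at h1
  rw [← hd, ← e] at h1
  simp only [hW, add_comp, mul_comp, C_comp, X_comp] at h1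
  rw [ChebyshevEquation, ← hequiv.natDegree_eq]
  have h2 : (C a : ℂ[X]) ^ 2 ≠ 0 := pow_ne_zero _ (C_ne_zero.2 ha)
  apply mul_left_cancel₀ h2
  simp only [C_add, C_mul] at h1
  have h3 : (C 2 : ℂ[X]) = 2 := rfl
  rw [h3] at h1
  linear_combination h1

theorem ChebyshevEquation.linear_equation {A : ℂ[X]} (hA : 1 ≤ A.natDegree)
    (h : ChebyshevEquation A) :
    X * derivative A + (X ^ 2 - 1) * derivative (derivative A) =
      C ((A.natDegree : ℂ) ^ 2) * A := by
  have h1 := congrArg derivative h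
  simp only [derivative_mul, derivative_C, derivative_sub, derivative_one,
    derivative_pow] at h1
  have h2 : 2 * derivative A ≠ 0 := mul_ne_zero two_ne_zero (derivative_ne_zero hA)
  apply mul_left_cancel₀ h2
  simp at h1
  have h3 : (C 2 : ℂ[X]) = 2 := rfl
  rw [h3] at h1
  simp only [C_pow, C_eq_natCast] at h1 ⊢
  linear_combination h1

theorem natDegree_eq_of_chebyshev_linear_equation {D : ℂ[X]} (hD : D ≠ 0) {n : ℕ}
    (h : X * derivative D + (X ^ 2 - 1) * derivative (derivative D) = C ((n : ℂ) ^ 2) * D) :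
    D.natDegree = n := by
  have hlc : D.coeff D.natDegree ≠ 0 := by rwa [coeff_natDegree, Ne, leadingCoeff_eq_zero]
  have htop : D.coeff (D.natDegree + 2) = 0 := coeff_eq_zero_of_natDegree_lt (by omega)
  have h1 := congrArg (fun p => p.coeff D.natDegree) h
  have h2 : (D.natDegree : ℂ) ^ 2 * D.coeff D.natDegree = n ^ 2 * D.coeff D.natDegree := by
    rw [sub_mul, one_mul] at h1
    simp only [coeff_add, coeff_sub, coeff_C_mul] at h1
    rw [← h1]
    generalize D.natDegree = k at htop
    rcases k with _ | _ | k
    · simp [coeff_derivative, htop]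
    · simp [coeff_derivative, htop, coeff_X_pow_mul']
    · simp [coeff_derivative, htop, coeff_X_pow_mul']
      ring
  have h3 := mul_right_cancel₀ hlc h2
  rw [← Nat.cast_pow, ← Nat.cast_pow, Nat.cast_inj] at h3
  exact Nat.pow_left_injective two_ne_zero h3

theorem ChebyshevEquation.eval_one_sq {A : ℂ[X]} (hA : 1 ≤ A.natDegree)
    (h : ChebyshevEquation A) : A.eval 1 ^ 2 = 1 := by
  have h1 := congrArg (eval 1) h
  have h2 : A.natDegree ≠ 0 := by omega
  simpa [h2, sub_eq_zero, zero_eq_mul] using h1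

theorem ChebyshevEquation.eq_or_eq_neg {A B : ℂ[X]} (hA : 1 ≤ A.natDegree)
    (hAB : A.natDegree = B.natDegree) (hA' : ChebyshevEquation A) (hB' : ChebyshevEquation B) :
    A = B ∨ A = -B := by
  have hB : 1 ≤ B.natDegree := hAB ▸ hA
  have hlc : B.leadingCoeff ≠ 0 := by
    rw [Ne, leadingCoeff_eq_zero]
    rintro rfl
    simp at hB
  set c := A.leadingCoeff / B.leadingCoeff with hc
  have hAcB : A = C c * B := by
    rw [← sub_eq_zero]
    by_contra hne
    have h1 := natDegree_eq_of_chebyshev_linear_equation (n := A.natDegree) hne (by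
      have hA'' := hA'.linear_equation hA
      have hB'' := hB'.linear_equation hB
      rw [← hAB] at hB''
      simp only [derivative_sub, derivative_C_mul]
      linear_combination hA'' - C c * hB'')
    apply hne
    rw [← leadingCoeff_eq_zero, leadingCoeff, h1, coeff_sub, coeff_C_mul, coeff_natDegree, hAB,
      coeff_natDegree, hc, div_mul_cancel₀ _ hlc, sub_self]
  have hc2 : c ^ 2 = 1 := by
    have h1 := hA'.eval_one_sq hA
    rwa [hAcB, eval_mul, eval_C, mul_pow, hB'.eval_one_sq hB, mul_one] at h1
  rcases sq_eq_one_iff.1 hc2 with h | h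
  · left; rw [hAcB, h, C_1, one_mul]
  · right; rw [hAcB, h, C_neg, C_1, neg_one_mul]

theorem ChebyshevEquation.comp_neg_X {A : ℂ[X]} (h : ChebyshevEquation A) :
    ChebyshevEquation (A.comp (-X)) := by
  have h1 := congrArg (fun p => p.comp (-X)) h
  simp only [mul_comp, pow_comp, sub_comp, X_comp, C_comp, one_comp] at h1
  rw [ChebyshevEquation, natDegree_comp, natDegree_neg, natDegree_X, mul_one, derivative_comp,
    ← h1, derivative_neg, derivative_X]
  ring

/-- A nonconstant semiconjugacy raises the multiplier of a fixed point to its local degree. -/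
theorem exists_eval_derivative_pow_eq {A B P : ℂ[X]} (hP : 1 ≤ P.natDegree)
    (e : P.comp B = A.comp P) {z : ℂ} (hz : B.eval z = z) :
    ∃ m, 1 ≤ m ∧ (derivative B).eval z ^ m = (derivative A).eval (P.eval z) := by
  have hfix : A.eval (P.eval z) = P.eval z := by
    have := congrArg (eval z) e
    rwa [eval_comp, eval_comp, hz, eq_comm] at this
  set x := P.eval z with hx
  have hP0 := sub_C_ne_zero hP x
  obtain ⟨g, hg, hgz⟩ := exists_eq_pow_rootMultiplicity_mul_and_not_dvd _ hP0 z
  set m := rootMultiplicity z (P - C x) with hm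
  obtain ⟨b, hb⟩ : X - C z ∣ B - C z := dvd_iff_isRoot.2 (by simp [hz])
  obtain ⟨α, hα⟩ : X - C x ∣ A - C x := dvd_iff_isRoot.2 (by simp [hfix])
  have hm1 : 1 ≤ m := (rootMultiplicity_pos hP0).2 (by simp [hx])
  refine ⟨m, hm1, ?_⟩
  have hb' : (derivative B).eval z = b.eval z := by
    have := congrArg (fun p => (derivative p).eval z) hb
    simpa using this
  have hα' : (derivative A).eval x = α.eval x := by
    have := congrArg (fun p => (derivative p).eval x) hα
    simpa using this
  have h1 : (P - C x).comp B = (A - C x).comp P := by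
    rw [sub_comp, sub_comp, e, C_comp, C_comp]
  have h2 : (X - C z) ^ m * (b ^ m * g.comp B) = (X - C z) ^ m * (g * α.comp P) := by
    calc
      _ = ((X - C z) ^ m * g).comp B := by
        rw [mul_comp, pow_comp, sub_comp, X_comp, C_comp, hb, mul_pow, mul_assoc]
      _ = ((X - C x) * α).comp P := by rw [← hg, h1, hα]
      _ = _ := by rw [mul_comp, sub_comp, X_comp, C_comp, hg, mul_assoc]
  have h3 := mul_left_cancel₀ (pow_ne_zero m (X_sub_C_ne_zero z)) h2
  have h4 := congrArg (eval z) h3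
  rw [eval_mul, eval_mul, eval_pow, eval_comp, eval_comp, hz, ← hx,
    mul_comm (eval z g)] at h4
  rw [hb', hα']
  exact mul_right_cancel₀ (fun h0 => hgz (dvd_iff_isRoot.2 h0)) h4

theorem ChebyshevEquation.not_semiconj {A B P : ℂ[X]} (hA : 2 ≤ A.natDegree)
    (hP : 1 ≤ P.natDegree) (hA' : ChebyshevEquation A) (hB' : ChebyshevEquation B)
    (hA1 : A.eval 1 = -1) (hAneg : A.eval (-1) = 1) (hB1 : B.eval 1 = 1) :
    P.comp B ≠ A.comp P := by
  intro e
  have hAB := natDegree_eq_of_semiconj hP e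
  obtain ⟨m, hm, h⟩ := exists_eval_derivative_pow_eq hP e hB1
  have hfix : A.eval (P.eval 1) = P.eval 1 := by
    have := congrArg (eval 1) e
    rwa [eval_comp, eval_comp, hB1, eq_comm] at this
  set x := P.eval 1
  have hx : x ^ 2 - 1 ≠ 0 := by
    intro h0
    rcases sq_eq_one_iff.1 (sub_eq_zero.1 h0) with hx | hx
    · rw [hx, hA1] at hfix
      norm_num at hfix
    · rw [hx, hAneg] at hfix
      norm_num at hfix
  have h1 : (derivative A).eval x ^ 2 = (A.natDegree : ℂ) ^ 2 := by
    have := congrArg (eval x) hA'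
    simp only [eval_mul, eval_pow, eval_sub, eval_X, eval_one, eval_C, hfix] at this
    exact mul_right_cancel₀ hx this
  have h2 : (derivative B).eval 1 = (A.natDegree : ℂ) ^ 2 := by
    have := congrArg (eval 1) (hB'.linear_equation (by omega))
    simpa [hB1, ← hAB] using this
  rw [← h, h2, ← pow_mul, ← pow_mul, ← Nat.cast_pow, ← Nat.cast_pow, Nat.cast_inj] at h1
  have h3 := Nat.pow_right_injective hA h1
  omega

theorem ChebyshevEquation.elementaryEquiv {A B P Q : ℂ[X]} (hA : 2 ≤ A.natDegree)
    (hP : 1 ≤ P.natDegree) (hQ : 1 ≤ Q.natDegree) (hPB : P.comp B = A.comp P)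
    (hQA : Q.comp A = B.comp Q) (hA' : ChebyshevEquation A) (hB' : ChebyshevEquation B) :
    ElementaryEquiv A B := by
  have hAB := natDegree_eq_of_semiconj hP hPB
  rcases hA'.eq_or_eq_neg (by omega) hAB hB' with h | h
  · rw [h]
    exact ElementaryEquiv.refl B
  rcases hB'.comp_neg_X.eq_or_eq_neg (by simp [natDegree_comp]; omega)
    (by simp [natDegree_comp]) hB' with hB | hB
  · refine ElementaryEquiv.of_linear_semiconj (a := -1) 0 (by norm_num) ?_
    simp [h, hB]
  · exfalso
    have hBneg : B.eval (-1) = -B.eval 1 := by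
      simpa [eval_comp] using congrArg (eval 1) hB
    have hAe : ∀ z, A.eval z = -B.eval z := fun z => by rw [h, eval_neg]
    rcases sq_eq_one_iff.1 (hB'.eval_one_sq (by omega)) with hB1 | hB1
    · exact ChebyshevEquation.not_semiconj hA hP hA' hB' (by rw [hAe, hB1])
        (by rw [hAe, hBneg, hB1, neg_neg]) hB1 hPB
    · exact ChebyshevEquation.not_semiconj (by omega) hQ hB' hA' hB1
        (by rw [hBneg, hB1, neg_neg]) (by rw [hAe, hB1, neg_neg]) hQA

theorem ElementaryEquiv.exists_semiconj_transport {A A₁ B B₁ P : ℂ[X]} (hA : 1 ≤ A.natDegree)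
    (hP : 1 ≤ P.natDegree) (e : P.comp B = A.comp P) (h : ElementaryEquiv A A₁)
    (h' : ElementaryEquiv B B₁) : ∃ Q : ℂ[X], 1 ≤ Q.natDegree ∧ Q.comp B₁ = A₁.comp Q := by
  have hAB := natDegree_eq_of_semiconj hP e
  obtain ⟨V, hV, eV⟩ := h.exists_semiconj hA
  obtain ⟨W, hW, eW⟩ := h'.symm.exists_semiconj (by rw [← h'.natDegree_eq]; omega)
  refine ⟨V.comp (P.comp W), ?_, ?_⟩
  · rw [natDegree_comp, natDegree_comp]
    exact Nat.mul_pos hV (Nat.mul_pos hP hW)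
  · rw [comp_assoc, comp_assoc, eW, ← comp_assoc P, e, comp_assoc A, ← comp_assoc V, eV,
      comp_assoc]

theorem powerType_or_chebyshevType_of_not_elementaryEquiv {A B P Q : ℂ[X]}
    (hA : 2 ≤ A.natDegree) (hP : 1 ≤ P.natDegree) (hQ : 1 ≤ Q.natDegree)
    (hPB : P.comp B = A.comp P) (hQA : Q.comp A = B.comp Q) (hAB : ¬ ElementaryEquiv A B) :
    PowerType A ∨ ChebyshevType A := by
  have hdeg := natDegree_eq_of_semiconj hP hPB
  obtain ⟨D, R, hR, e, hinj, -⟩ := exists_genericallyInjective_semiconj_of_large_degree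
    (by omega : 1 ≤ A.natDegree) (by omega : 1 ≤ B.natDegree) hAB hP hQ hPB hQA A.natDegree
  have : A.natDegree < 2 ^ (A.natDegree + 1) :=
    (Nat.lt_succ_self _).trans Nat.lt_two_pow_self
  exact powerType_or_chebyshevType hA (by omega) e hinj

theorem ElementaryEquiv.of_mutual_semiconj {A B P Q : ℂ[X]} (hA : 2 ≤ A.natDegree)
    (hP : 1 ≤ P.natDegree) (hQ : 1 ≤ Q.natDegree) (hPB : P.comp B = A.comp P)
    (hQA : Q.comp A = B.comp Q) : ElementaryEquiv A B := by
  by_contra hAB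
  have hdeg := natDegree_eq_of_semiconj hP hPB
  have hB : 2 ≤ B.natDegree := by omega
  have of_powerType : PowerType A → PowerType B → False := fun hA' hB' =>
    hAB <| (hA'.elementaryEquiv_X_pow hA).trans <|
      hdeg ▸ (hB'.elementaryEquiv_X_pow hB).symm
  rcases powerType_or_chebyshevType_of_not_elementaryEquiv hA hP hQ hPB hQA hAB with hA' | hA'
  · exact of_powerType hA' (hA'.of_semiconj hA hP hPB)
  rcases powerType_or_chebyshevType_of_not_elementaryEquiv hB hQ hP hQA hPB
    (fun h => hAB h.symm) with hB' | hB'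
  · exact of_powerType (hB'.of_semiconj hB hQ hQA) hB'
  obtain ⟨A₁, hA₁, hA₁'⟩ := hA'.exists_chebyshevEquation
  obtain ⟨B₁, hB₁, hB₁'⟩ := hB'.exists_chebyshevEquation
  obtain ⟨P₁, hP₁, e⟩ := ElementaryEquiv.exists_semiconj_transport (by omega) hP hPB hA₁ hB₁
  obtain ⟨Q₁, hQ₁, e'⟩ := ElementaryEquiv.exists_semiconj_transport (by omega) hQ hQA hB₁ hA₁
  exact hAB <| hA₁.trans <|
    (hA₁'.elementaryEquiv (hA₁.natDegree_eq ▸ hA) hP₁ hQ₁ e e' hB₁').trans hB₁.symm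

/-- Mutually semiconjugate polynomials over ℂ are equivalent: related by the
equivalence relation generated by elementary transformations
`U ∘ V ↦ V ∘ U`. -/
theorem mutually_semiconjugate_polynomials_equivalent
    (A B X Y : Polynomial ℂ)
    (hA : 2 ≤ A.natDegree) (hB : 2 ≤ B.natDegree)
    (hX : 1 ≤ X.natDegree) (hY : 1 ≤ Y.natDegree)
    (hXB : X.comp B = A.comp X) (hYA : Y.comp A = B.comp Y) :
    Relation.EqvGen
      (fun f g : Polynomial ℂ => ∃ U V : Polynomial ℂ,
        f = U.comp V ∧ g = V.comp U) A B := by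
  exact ElementaryEquiv.of_mutual_semiconj hA hX hY hXB hYA
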